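/- Fix an integer d ≥ 2 and a real m > 0, and define the internal energy per particle e(z) := m·(G_1(z) − 1/z) for z > 0. Then e is strictly monotonically decreasing on (0,∞) (equivalently, the internal energy per particle is strictly increasing in the temperature T, where z = m/(k_B T)), e(z) → m as z → ∞, and z·e(z)/m → d as z → 0⁺ (i.e. e/(k_B T) → d in the ultrarelativistic limit). -/

import Mathlib

open MeasureTheory Real Filter

/-- The modified Bessel function of the second kind, defined via its integral
representation `K_ν(z) = ∫_0^∞ exp(−z cosh t) cosh(ν t) dt`. -/
noncomputable def besselK (ν z : ℝ) : ℝ :=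
  ∫ t in Set.Ioi (0:ℝ), Real.exp (-z * Real.cosh t) * Real.cosh (ν * t)

/-- The ratio `G_k(z) = K_{(d+1)/2+k}(z) / K_{(d+1)/2}(z)`. -/
noncomputable def G (d k : ℤ) (z : ℝ) : ℝ :=
  besselK (((d : ℝ) + 1) / 2 + (k : ℝ)) z / besselK (((d : ℝ) + 1) / 2) z

theorem cosh_le_exp_of_abs_le {x y : ℝ} (h : |x| ≤ y) : cosh x ≤ exp y := by
  rw [← cosh_abs, ← cosh_add_sinh]
  have h₁ : cosh |x| ≤ cosh y :=
    cosh_le_cosh.2 (by rwa [abs_abs, abs_of_nonneg ((abs_nonneg x).trans h)])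
  have h₂ : 0 ≤ sinh y := sinh_nonneg_iff.2 ((abs_nonneg x).trans h)
  linarith

/-- The integrand of `besselK` decays exponentially. -/
theorem besselK_integrand_le (ν : ℝ) {z t : ℝ} (hz : 0 < z) (ht : 0 ≤ t) :
    exp (-z * cosh t) * cosh (ν * t) ≤ exp ((|ν| + 1) ^ 2 / (2 * z)) * exp (-1 * t) := by
  have h₁ : cosh (ν * t) ≤ exp (|ν| * t) :=
    cosh_le_exp_of_abs_le (by rw [abs_mul, abs_of_nonneg ht])
  have h₂ : t ^ 2 / 2 ≤ cosh t := by
    have h : t / 2 ≤ sinh (t / 2) := self_le_sinh_iff.2 (by positivity)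
    have h' := cosh_sq' (t / 2)
    rw [show t = 2 * (t / 2) by ring, cosh_two_mul]
    nlinarith
  have h₃ : z * (t ^ 2 / 2) ≤ z * cosh t := mul_le_mul_of_nonneg_left h₂ hz.le
  have h₄ : (|ν| + 1) * t - z * (t ^ 2 / 2) ≤ (|ν| + 1) ^ 2 / (2 * z) := by
    rw [le_div_iff₀ (by positivity)]
    nlinarith [sq_nonneg (z * t - (|ν| + 1))]
  calc exp (-z * cosh t) * cosh (ν * t) ≤ exp (-z * cosh t) * exp (|ν| * t) := by gcongr
    _ = exp (-z * cosh t + |ν| * t) := (exp_add _ _).symm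
    _ ≤ exp ((|ν| + 1) ^ 2 / (2 * z) + -1 * t) := exp_le_exp.2 (by linarith)
    _ = _ := exp_add _ _

theorem integrableOn_besselK (ν : ℝ) {z : ℝ} (hz : 0 < z) :
    IntegrableOn (fun t => exp (-z * cosh t) * cosh (ν * t)) (Set.Ioi 0) := by
  refine Integrable.mono' ((exp_neg_integrableOn_Ioi 0 one_pos).const_mul
    (exp ((|ν| + 1) ^ 2 / (2 * z)))) (by fun_prop) ?_
  filter_upwards [ae_restrict_mem measurableSet_Ioi] with t ht
  rw [norm_of_nonneg (mul_nonneg (exp_pos _).le (cosh_pos _).le)]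
  exact besselK_integrand_le ν hz (le_of_lt ht)

theorem besselK_pos (ν : ℝ) {z : ℝ} (hz : 0 < z) : 0 < besselK ν z := by
  have hpos : ∀ t, 0 < exp (-z * cosh t) * cosh (ν * t) :=
    fun t => mul_pos (exp_pos _) (cosh_pos _)
  rw [besselK, integral_pos_iff_support_of_nonneg (fun t => (hpos t).le)
    (integrableOn_besselK ν hz), Function.support_eq_univ fun t => (hpos t).ne']
  simp

/-- The three-term recurrence `K_{ν+1} - K_{ν-1} = (2ν/z) K_ν`. -/
theorem besselK_add_one_sub (ν : ℝ) {z : ℝ} (hz : 0 < z) :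
    besselK (ν + 1) z - besselK (ν - 1) z = 2 * ν / z * besselK ν z := by
  have hI : IntegrableOn (fun t => ν * (exp (-z * cosh t) * cosh (ν * t)) - z / 2 *
      (exp (-z * cosh t) * cosh ((ν + 1) * t) - exp (-z * cosh t) * cosh ((ν - 1) * t)))
      (Set.Ioi 0) := ((integrableOn_besselK ν hz).const_mul ν).sub
    (((integrableOn_besselK (ν + 1) hz).sub (integrableOn_besselK (ν - 1) hz)).const_mul (z / 2))
  have hlim : Tendsto (fun t => exp (-z * cosh t) * sinh (ν * t)) atTop (nhds 0) := by
    have hb : Tendsto (fun t => exp ((|ν| + 1) ^ 2 / (2 * z)) * exp (-1 * t)) atTop (nhds 0) := by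
      simpa using (tendsto_exp_neg_atTop_nhds_zero.const_mul (exp ((|ν| + 1) ^ 2 / (2 * z))))
    refine squeeze_zero_norm' ?_ hb
    filter_upwards [eventually_ge_atTop 0] with t ht
    refine le_trans ?_ (besselK_integrand_le ν hz ht)
    rw [norm_mul, norm_of_nonneg (exp_pos _).le, norm_eq_abs]
    gcongr
    rw [abs_sinh, ← cosh_abs]
    exact (sinh_lt_cosh _).le
  have h := integral_Ioi_of_hasDerivAt_of_tendsto' (a := 0) (fun t _ => by
    have h₁ := (((hasDerivAt_cosh t).const_mul (-z)).exp).mul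
      (((hasDerivAt_id t).const_mul ν).sinh)
    refine h₁.congr_deriv (g' := ν * (exp (-z * cosh t) * cosh (ν * t)) - z / 2 *
      (exp (-z * cosh t) * cosh ((ν + 1) * t) - exp (-z * cosh t) * cosh ((ν - 1) * t))) ?_
    rw [add_mul, sub_mul, one_mul, cosh_add, cosh_sub]
    simp only [id]
    ring) hI hlim
  rw [integral_sub, integral_const_mul, integral_const_mul, integral_sub] at h
  · simp only [mul_zero, sinh_zero, sub_zero] at h
    change ν * besselK ν z - z / 2 * (besselK (ν + 1) z - besselK (ν - 1) z) = 0 at h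
    field_simp
    linarith
  · exact integrableOn_besselK _ hz
  · exact integrableOn_besselK _ hz
  · exact (integrableOn_besselK _ hz).const_mul _
  · exact ((integrableOn_besselK (ν + 1) hz).sub (integrableOn_besselK (ν - 1) hz)).const_mul _

theorem besselK_sub_one_le {ν z : ℝ} (hν : 1 / 2 ≤ ν) (hz : 0 < z) :
    besselK (ν - 1) z ≤ besselK ν z := by
  refine setIntegral_mono_on (integrableOn_besselK _ hz) (integrableOn_besselK _ hz)
    measurableSet_Ioi fun t _ => ?_
  gcongr
  rw [cosh_le_cosh, abs_mul, abs_mul]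
  refine mul_le_mul_of_nonneg_right ?_ (abs_nonneg t)
  rw [abs_of_nonneg (a := ν) (by linarith), abs_le]
  constructor <;> linarith

theorem integral_cosh_sub_mul_besselK_integrand (ν r : ℝ) {z : ℝ} (hz : 0 < z) :
    IntegrableOn (fun t => (cosh t - r) * (exp (-z * cosh t) * cosh (ν * t))) (Set.Ioi 0) ∧
    ∫ t in Set.Ioi (0 : ℝ), (cosh t - r) * (exp (-z * cosh t) * cosh (ν * t)) =
      (besselK (ν + 1) z + besselK (ν - 1) z) / 2 - r * besselK ν z := by
  have h₁ : IntegrableOn (fun t => (exp (-z * cosh t) * cosh ((ν + 1) * t) +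
      exp (-z * cosh t) * cosh ((ν - 1) * t)) / 2) (Set.Ioi 0) :=
    ((integrableOn_besselK (ν + 1) hz).add (integrableOn_besselK (ν - 1) hz)).div_const 2
  have h₂ := (integrableOn_besselK ν hz).const_mul r
  have heq : (fun t => (cosh t - r) * (exp (-z * cosh t) * cosh (ν * t))) = fun t =>
      (exp (-z * cosh t) * cosh ((ν + 1) * t) + exp (-z * cosh t) * cosh ((ν - 1) * t)) / 2 -
        r * (exp (-z * cosh t) * cosh (ν * t)) := by
    ext t
    rw [add_mul, sub_mul ν, one_mul, cosh_add, cosh_sub]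
    ring
  rw [heq]
  refine ⟨h₁.sub h₂, ?_⟩
  rw [integral_sub h₁ h₂, integral_const_mul, integral_div, integral_add
    (integrableOn_besselK _ hz) (integrableOn_besselK _ hz)]
  rfl

/-- The negative logarithmic derivative `(K_{ν+1} + K_{ν-1}) / (2 K_ν)` is decreasing, that is,
`K_ν` is log-convex. -/
theorem antitoneOn_besselK_logDeriv (ν : ℝ) :
    AntitoneOn (fun z => (besselK (ν + 1) z + besselK (ν - 1) z) / 2 / besselK ν z)
      (Set.Ioi 0) := by
  intro z hz w hw hzw
  simp only [Set.mem_Ioi] at hz hw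
  set r := (besselK (ν + 1) z + besselK (ν - 1) z) / 2 / besselK ν z with hr
  obtain ⟨hIz, hz'⟩ := integral_cosh_sub_mul_besselK_integrand ν r hz
  obtain ⟨hIw, hw'⟩ := integral_cosh_sub_mul_besselK_integrand ν r hw
  have hzero : (besselK (ν + 1) z + besselK (ν - 1) z) / 2 - r * besselK ν z = 0 := by
    rw [hr, div_mul_cancel₀ _ (besselK_pos ν hz).ne', sub_self]
  have hle := setIntegral_mono_on hIw (hIz.const_mul (exp (-(w - z) * r))) measurableSet_Ioi
    fun t _ => by
      have hw_eq : exp (-w * cosh t) = exp (-(w - z) * cosh t) * exp (-z * cosh t) := by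
        rw [← exp_add]; ring_nf
      have key : (cosh t - r) * exp (-(w - z) * cosh t) ≤
          (cosh t - r) * exp (-(w - z) * r) := by
        rcases le_total r (cosh t) with h | h
        · exact mul_le_mul_of_nonneg_left (exp_le_exp.2 (by nlinarith)) (by linarith)
        · exact mul_le_mul_of_nonpos_left (exp_le_exp.2 (by nlinarith)) (by linarith)
      have hnn : 0 ≤ exp (-z * cosh t) * cosh (ν * t) :=
        mul_nonneg (exp_pos _).le (cosh_pos _).le
      calc _ = (cosh t - r) * exp (-(w - z) * cosh t) * (exp (-z * cosh t) * cosh (ν * t)) := by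
            rw [hw_eq]; ring
        _ ≤ (cosh t - r) * exp (-(w - z) * r) * (exp (-z * cosh t) * cosh (ν * t)) :=
            mul_le_mul_of_nonneg_right key hnn
        _ = _ := by ring
  rw [integral_const_mul, hz', hzero, mul_zero, hw'] at hle
  change _ / besselK ν w ≤ r
  rw [div_le_iff₀ (besselK_pos ν hw)]
  linarith

/-- The internal energy per particle `e(z) = m (G_1(z) − 1/z)` is strictly decreasing
in `z` (i.e. strictly increasing in the temperature `T`), `e(z) → m` as `z → ∞`, and
`z e(z)/m → d` as `z → 0⁺` (i.e. `e/(k_B T) → d` in the ultrarelativistic limit). -/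
theorem internal_energy_props (d : ℤ) (hd : 2 ≤ d) (m : ℝ) (hm : 0 < m) :
    StrictAntiOn (fun z : ℝ => m * (G d 1 z - 1 / z)) (Set.Ioi 0) ∧
    Tendsto (fun z : ℝ => m * (G d 1 z - 1 / z)) atTop (nhds m) ∧
    Tendsto (fun z : ℝ => z * (m * (G d 1 z - 1 / z)) / m) (nhdsWithin 0 (Set.Ioi 0))
      (nhds (d : ℝ)) := by
  have hd' : (2 : ℝ) ≤ d := by exact_mod_cast hd
  obtain ⟨a, ha⟩ : ∃ a : ℝ, a = ((d : ℝ) + 1) / 2 := ⟨_, rfl⟩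
  have had : (d : ℝ) = 2 * a - 1 := by linarith
  have ha1 : 1 < a := by linarith
  have hG : ∀ z, G d 1 z = besselK (a + 1) z / besselK a z := fun z => by simp [G, ha]
  have hlog : ∀ z, 0 < z → G d 1 z - 1 / z =
      (besselK (a + 1) z + besselK (a - 1) z) / 2 / besselK a z + (a - 1) / z := fun z hz => by
    have hrec := besselK_add_one_sub a hz
    have hK := (besselK_pos a hz).ne'
    rw [hG, show besselK (a - 1) z = besselK (a + 1) z - 2 * a / z * besselK a z by linarith]
    field_simp
    ring
  have hratio : ∀ z, 0 < z → G d 1 z - 1 / z =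
      besselK (a - 1) z / besselK a z + d / z := fun z hz => by
    have hrec := besselK_add_one_sub a hz
    have hK := (besselK_pos a hz).ne'
    rw [hG, had, show besselK (a + 1) z = besselK (a - 1) z + 2 * a / z * besselK a z by linarith]
    field_simp
    ring
  have hratio_le : ∀ z, 0 < z → besselK (a - 1) z / besselK a z ≤ 1 := fun z hz =>
    (div_le_one (besselK_pos a hz)).2 (besselK_sub_one_le (by linarith) hz)
  have hratio_pos : ∀ z, 0 < z → 0 < besselK (a - 1) z / besselK a z := fun z hz =>
    div_pos (besselK_pos _ hz) (besselK_pos _ hz)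
  refine ⟨fun z hz w hw hzw => ?_, ?_, ?_⟩
  · refine mul_lt_mul_of_pos_left ?_ hm
    rw [hlog z hz, hlog w hw]
    exact add_lt_add_of_le_of_lt (antitoneOn_besselK_logDeriv a hz hw hzw.le)
      (div_lt_div_of_pos_left (by linarith) hz hzw)
  · have hlim : Tendsto (fun z : ℝ => G d 1 z - 1 / z) atTop (nhds 1) := by
      have hinv : ∀ c : ℝ, Tendsto (fun z : ℝ => 1 + c / z) atTop (nhds 1) := fun c => by
        simpa using (tendsto_const_nhds (x := (1 : ℝ))).add
          ((tendsto_const_nhds (x := c)).div_atTop tendsto_id)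
      refine tendsto_of_tendsto_of_tendsto_of_le_of_le' tendsto_const_nhds (hinv d) ?_ ?_
      · filter_upwards [eventually_gt_atTop 0] with z hz
        rw [hlog z hz]
        have h := (integral_cosh_sub_mul_besselK_integrand a 1 hz).2
        have hnn : 0 ≤ ∫ t in Set.Ioi (0 : ℝ), (cosh t - 1) * (exp (-z * cosh t) * cosh (a * t)) :=
          integral_nonneg fun t => mul_nonneg (sub_nonneg.2 (one_le_cosh t))
            (mul_nonneg (exp_pos _).le (cosh_pos _).le)
        have h₁ : 1 ≤ (besselK (a + 1) z + besselK (a - 1) z) / 2 / besselK a z :=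
          (one_le_div (besselK_pos a hz)).2 (by linarith)
        have h₂ : 0 < (a - 1) / z := div_pos (by linarith) hz
        linarith
      · filter_upwards [eventually_gt_atTop 0] with z hz
        rw [hratio z hz]
        linarith [hratio_le z hz]
    simpa using hlim.const_mul m
  · have hlim : Tendsto (fun z : ℝ => z + (d : ℝ)) (nhdsWithin 0 (Set.Ioi 0)) (nhds d) := by
      have h : Continuous fun z : ℝ => z + (d : ℝ) := by fun_prop
      simpa using (h.tendsto 0).mono_left nhdsWithin_le_nhds
    have heq : ∀ z, 0 < z → z * (m * (G d 1 z - 1 / z)) / m =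
        z * (besselK (a - 1) z / besselK a z) + d := fun z hz => by
      rw [hratio z hz]
      field_simp
    refine tendsto_of_tendsto_of_tendsto_of_le_of_le' tendsto_const_nhds hlim ?_ ?_
    · filter_upwards [self_mem_nhdsWithin] with z hz
      rw [heq z hz]
      linarith [mul_pos (show 0 < z from hz) (hratio_pos z hz)]
    · filter_upwards [self_mem_nhdsWithin] with z hz
      rw [heq z hz]
      linarith [mul_le_mul_of_nonneg_left (hratio_le z hz) (show 0 < z from hz).le]
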